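/- Convex-split lemma (mutual information bound): Let δ ∈ (0, 1/6). Let ρ_PQ be a density matrix on P×Q and σ_Q a density matrix on Q such that k := Dmax(ρ_PQ ‖ ρ_P ⊗ σ_Q) is finite. Set n := 1 if k ≤ 3δ, and n := ⌈8·2^k·log(k/δ)/δ³⌉ otherwise. Then the convex-split state τ on P×Q₁×…×Qₙ satisfies I(P : Q₁…Qₙ)_τ ≤ 3δ, where the mutual information is taken across the bipartition P versus Q₁×…×Qₙ. -/

import Mathlib

open scoped Kronecker BigOperators
open Matrix
open scoped ComplexOrder Classical

noncomputable section

/-- A density matrix: positive semidefinite with unit trace. -/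
def IsDensityMatrix {d : Type*} [Fintype d] (ρ : Matrix d d ℂ) : Prop :=
  ρ.PosSemidef ∧ ρ.trace = 1

/-- Loewner order on Hermitian matrices: `A ≤ B` iff `B - A` is positive semidefinite. -/
def LoewnerLE {d : Type*} [Fintype d] (A B : Matrix d d ℂ) : Prop := (B - A).PosSemidef

/-- Partial trace over the second tensor factor. -/
def ptrace2 {d₁ d₂ : Type*} [Fintype d₂] (M : Matrix (d₁ × d₂) (d₁ × d₂) ℂ) :
    Matrix d₁ d₁ ℂ :=
  fun i i' => ∑ k, M (i, k) (i', k)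

/-- Partial trace over the first tensor factor. -/
def ptrace1 {d₁ d₂ : Type*} [Fintype d₁] (M : Matrix (d₁ × d₂) (d₁ × d₂) ℂ) :
    Matrix d₂ d₂ ℂ :=
  fun j j' => ∑ k, M (k, j) (k, j')

/-- Functional calculus for Hermitian matrices: apply `f` to the eigenvalues. -/
def hermCFC {d : Type*} [Fintype d] [DecidableEq d] (f : ℝ → ℝ) (A : Matrix d d ℂ) :
    Matrix d d ℂ :=
  if hA : A.IsHermitian then
    (hA.eigenvectorUnitary : Matrix d d ℂ) *
      Matrix.diagonal (fun i => (f (hA.eigenvalues i) : ℂ)) *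
      (star (hA.eigenvectorUnitary : Matrix d d ℂ))
  else 0

/-- Matrix logarithm, base 2, applied to nonzero eigenvalues. -/
def matLog2 {d : Type*} [Fintype d] [DecidableEq d] (A : Matrix d d ℂ) : Matrix d d ℂ :=
  hermCFC (Real.logb 2) A

/-- Positive semidefinite square root (via functional calculus). -/
def matSqrt {d : Type*} [Fintype d] [DecidableEq d] (A : Matrix d d ℂ) : Matrix d d ℂ :=
  hermCFC Real.sqrt A

/-- Support containment: the kernel of `σ` is contained in the kernel of `ρ`. -/
def SupportLE {d : Type*} [Fintype d] (ρ σ : Matrix d d ℂ) : Prop :=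
  ∀ v : d → ℂ, σ.mulVec v = 0 → ρ.mulVec v = 0

/-- Relative entropy, base 2, as a real number (meaningful when supports are nested). -/
def relentR {d : Type*} [Fintype d] [DecidableEq d] (ρ σ : Matrix d d ℂ) : ℝ :=
  ((ρ * matLog2 ρ).trace - (ρ * matLog2 σ).trace).re

/-- Relative entropy `D(ρ‖σ)`, base 2, valued in the extended reals: `+∞` unless
the support of `ρ` is contained in the support of `σ`. -/
def relent {d : Type*} [Fintype d] [DecidableEq d] (ρ σ : Matrix d d ℂ) : EReal :=
  if SupportLE ρ σ then ((relentR ρ σ : ℝ) : EReal) else ⊤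

/-- Mutual information `I(A:B)_ρ = D(ρ_AB ‖ ρ_A ⊗ ρ_B)`. -/
def mutInfo {d₁ d₂ : Type*} [Fintype d₁] [Fintype d₂] [DecidableEq d₁] [DecidableEq d₂]
    (ρ : Matrix (d₁ × d₂) (d₁ × d₂) ℂ) : EReal :=
  relent ρ (ptrace2 ρ ⊗ₖ ptrace1 ρ)

/-- Fidelity `F(ρ,σ) = Tr √(√σ ρ √σ)`. -/
def fidelity {d : Type*} [Fintype d] [DecidableEq d] (ρ σ : Matrix d d ℂ) : ℝ :=
  ((matSqrt (matSqrt σ * ρ * matSqrt σ)).trace).re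

/-- Purified distance `P(ρ,σ) = √(1 - F(ρ,σ)²)`. -/
def pdist {d : Type*} [Fintype d] [DecidableEq d] (ρ σ : Matrix d d ℂ) : ℝ :=
  Real.sqrt (1 - (fidelity ρ σ) ^ 2)

/-- Max-relative entropy `Dmax(ρ‖σ) = inf {λ : ρ ≤ 2^λ σ}`, valued in the extended reals. -/
def dmax {d : Type*} [Fintype d] (ρ σ : Matrix d d ℂ) : EReal :=
  sInf {x : EReal | ∃ l : ℝ, x = (l : EReal) ∧ LoewnerLE ρ (((2 : ℝ) ^ l) • σ)}

/-- Max-information `Imax(A:B)_ρ`. -/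
def imax {d₁ d₂ : Type*} [Fintype d₁] [Fintype d₂]
    (ρ : Matrix (d₁ × d₂) (d₁ × d₂) ℂ) : EReal :=
  ⨅ σ : {σ : Matrix d₂ d₂ ℂ // IsDensityMatrix σ}, dmax ρ (ptrace2 ρ ⊗ₖ σ.1)

/-- Smooth max-information `Imax^ε(A:B)_ρ`. -/
def imaxEps {d₁ d₂ : Type*} [Fintype d₁] [Fintype d₂] [DecidableEq d₁] [DecidableEq d₂]
    (ε : ℝ) (ρ : Matrix (d₁ × d₂) (d₁ × d₂) ℂ) : EReal :=
  ⨅ ρ' : {ρ' : Matrix (d₁ × d₂) (d₁ × d₂) ℂ // IsDensityMatrix ρ' ∧ pdist ρ ρ' ≤ ε},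
    imax ρ'.1

/-- The `j`-th term of the convex split: `ρ` on `P` and the `j`-th copy of `Q`, and
`σ` on every other copy of `Q`. -/
def blockState {P Q : Type*} [Fintype Q] [DecidableEq Q]
    (ρ : Matrix (P × Q) (P × Q) ℂ) (σ : Matrix Q Q ℂ) (n : ℕ) (j : Fin n) :
    Matrix (P × (Fin n → Q)) (P × (Fin n → Q)) ℂ :=
  fun x y => ρ (x.1, x.2 j) (y.1, y.2 j) * ∏ i ∈ Finset.univ.erase j, σ (x.2 i) (y.2 i)

/-- The convex-split state `τ = (1/n) Σ_j ρ_{PQ_j} ⊗ σ_{Q_1} ⊗ ⋯ ⊗ σ_{Q_n}` (omitting `j`). -/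
def convexSplit {P Q : Type*} [Fintype Q] [DecidableEq Q]
    (ρ : Matrix (P × Q) (P × Q) ℂ) (σ : Matrix Q Q ℂ) (n : ℕ) :
    Matrix (P × (Fin n → Q)) (P × (Fin n → Q)) ℂ :=
  ((n : ℂ)⁻¹) • ∑ j : Fin n, blockState ρ σ n j

/-- A finite nonempty index type. -/
structure FinIdx where
  carrier : Type
  [fin : Fintype carrier]
  [deq : DecidableEq carrier]
  [ne : Nonempty carrier]

attribute [instance] FinIdx.fin FinIdx.deq FinIdx.ne

section Spectral

variable {d : Type*} [Fintype d] [DecidableEq d]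

lemma exists_unitary_diagonal {A : Matrix d d ℂ} (hA : A.PosSemidef) :
    ∃ (V : Matrix d d ℂ) (e : d → ℝ), Vᴴ * V = 1 ∧ (∀ i, 0 ≤ e i) ∧
      A = V * diagonal (fun i => (e i : ℂ)) * Vᴴ := by
  refine ⟨hA.1.eigenvectorUnitary, hA.1.eigenvalues, ?_, hA.eigenvalues_nonneg, ?_⟩
  · exact Unitary.coe_star_mul_self _
  · conv_lhs => rw [hA.1.spectral_theorem]
    rfl

lemma isHermitian_conj_diagonal (V : Matrix d d ℂ) (e : d → ℝ) :
    (V * diagonal (fun i => (e i : ℂ)) * Vᴴ).IsHermitian := by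
  apply isHermitian_mul_mul_conjTranspose
  simp [Matrix.IsHermitian, diagonal_conjTranspose, Pi.star_def]

lemma conj_diagonal_congr {V W : Matrix d d ℂ} (hV : Vᴴ * V = 1) (hW : Wᴴ * W = 1)
    {a b : d → ℝ}
    (h : V * diagonal (fun i => (a i : ℂ)) * Vᴴ = W * diagonal (fun i => (b i : ℂ)) * Wᴴ)
    (f : ℝ → ℝ) :
    V * diagonal (fun i => (f (a i) : ℂ)) * Vᴴ =
      W * diagonal (fun i => (f (b i) : ℂ)) * Wᴴ := by
  have hV' : V * Vᴴ = 1 := mul_eq_one_comm.mp hV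
  have hW' : W * Wᴴ = 1 := mul_eq_one_comm.mp hW
  have key : (Wᴴ * V) * diagonal (fun i => (a i : ℂ)) =
      diagonal (fun i => (b i : ℂ)) * (Wᴴ * V) := by
    calc (Wᴴ * V) * diagonal (fun i => (a i : ℂ))
        = Wᴴ * (V * diagonal (fun i => (a i : ℂ)) * Vᴴ) * V := by
          simp only [Matrix.mul_assoc, hV, Matrix.mul_one]
      _ = (Wᴴ * W) * diagonal (fun i => (b i : ℂ)) * (Wᴴ * V) := by
          rw [h]; simp only [Matrix.mul_assoc]
      _ = _ := by rw [hW, Matrix.one_mul]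
  have key' : (Wᴴ * V) * diagonal (fun i => (f (a i) : ℂ)) =
      diagonal (fun i => (f (b i) : ℂ)) * (Wᴴ * V) := by
    ext i j
    have hij := congrFun (congrFun key i) j
    rw [mul_diagonal, diagonal_mul] at hij ⊢
    by_cases h0 : (Wᴴ * V) i j = 0
    · simp [h0]
    · rw [mul_comm] at hij
      have : a j = b i := by exact_mod_cast mul_right_cancel₀ h0 hij
      rw [this, mul_comm]
  calc V * diagonal (fun i => (f (a i) : ℂ)) * Vᴴ
      = (W * Wᴴ) * V * diagonal (fun i => (f (a i) : ℂ)) * Vᴴ := by rw [hW', Matrix.one_mul]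
    _ = W * ((Wᴴ * V) * diagonal (fun i => (f (a i) : ℂ))) * Vᴴ := by
        simp only [Matrix.mul_assoc]
    _ = W * diagonal (fun i => (f (b i) : ℂ)) * Wᴴ * (V * Vᴴ) := by
        rw [key']; simp only [Matrix.mul_assoc]
    _ = _ := by rw [hV', Matrix.mul_one]

lemma hermCFC_conj_diagonal {V : Matrix d d ℂ} (hV : Vᴴ * V = 1) (e : d → ℝ) (f : ℝ → ℝ) :
    hermCFC f (V * diagonal (fun i => (e i : ℂ)) * Vᴴ) =
      V * diagonal (fun i => (f (e i) : ℂ)) * Vᴴ := by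
  have hA := isHermitian_conj_diagonal V e
  rw [hermCFC, dif_pos hA]
  refine conj_diagonal_congr (Unitary.coe_star_mul_self _) hV ?_ f
  conv_rhs => rw [hA.spectral_theorem]
  rfl

lemma re_trace_mul_matLog2 (ρ : Matrix d d ℂ) {V : Matrix d d ℂ} (hV : Vᴴ * V = 1)
    (e : d → ℝ) :
    ((ρ * matLog2 (V * diagonal (fun i => (e i : ℂ)) * Vᴴ)).trace).re =
      ∑ x, ((Vᴴ * ρ * V) x x).re * Real.logb 2 (e x) := by
  rw [matLog2, hermCFC_conj_diagonal hV, ← Matrix.mul_assoc, Matrix.trace_mul_comm,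
    ← Matrix.mul_assoc, ← Matrix.mul_assoc, Matrix.trace, Complex.re_sum]
  refine Finset.sum_congr rfl fun x _ => ?_
  rw [diag_apply, mul_diagonal, Complex.re_mul_ofReal]

lemma conjTranspose_mul_conj_diagonal_mul {V : Matrix d d ℂ} (hV : Vᴴ * V = 1) (e : d → ℂ) :
    Vᴴ * (V * diagonal e * Vᴴ) * V = diagonal e := by
  calc Vᴴ * (V * diagonal e * Vᴴ) * V = (Vᴴ * V) * diagonal e * (Vᴴ * V) := by
        simp only [Matrix.mul_assoc]
    _ = _ := by rw [hV, Matrix.one_mul, Matrix.mul_one]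

lemma relentR_conj_diagonal {U V : Matrix d d ℂ} (hU : Uᴴ * U = 1) (hV : Vᴴ * V = 1)
    (t e : d → ℝ) {ρ σ : Matrix d d ℂ}
    (hρ : ρ = U * diagonal (fun i => (t i : ℂ)) * Uᴴ)
    (hσ : σ = V * diagonal (fun i => (e i : ℂ)) * Vᴴ) :
    relentR ρ σ = ∑ i, t i * Real.logb 2 (t i) -
      ∑ x, ((Vᴴ * ρ * V) x x).re * Real.logb 2 (e x) := by
  have h1 : (ρ * matLog2 ρ).trace.re = ∑ i, t i * Real.logb 2 (t i) := by
    conv_lhs => rw [hρ]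
    rw [re_trace_mul_matLog2 _ hU, conjTranspose_mul_conj_diagonal_mul hU]
    simp
  rw [relentR, Complex.sub_re, h1, hσ, re_trace_mul_matLog2 _ hV]

lemma col_eq_zero_of_diag_eq_zero {A : Matrix d d ℂ} (hA : A.PosSemidef) {x : d}
    (hx : A x x = 0) (y : d) : A y x = 0 := by
  have h := (hA.dotProduct_mulVec_zero_iff (Pi.single x 1)).mp (by simp [hx])
  simpa using congrFun h y

lemma supportLE_of_diag {ρ σ V : Matrix d d ℂ} (hV : Vᴴ * V = 1) (hρ : ρ.PosSemidef)
    (e : d → ℝ) (hσ : σ = V * diagonal (fun i => (e i : ℂ)) * Vᴴ)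
    (h : ∀ x, e x = 0 → (Vᴴ * ρ * V) x x = 0) : SupportLE ρ σ := by
  intro v hv
  have hV' : V * Vᴴ = 1 := mul_eq_one_comm.mp hV
  have hw : ∀ x, (e x : ℂ) * (Vᴴ *ᵥ v) x = 0 := by
    intro x
    have : (diagonal (fun i => (e i : ℂ))) *ᵥ (Vᴴ *ᵥ v) = Vᴴ *ᵥ (σ *ᵥ v) := by
      rw [hσ, mulVec_mulVec, mulVec_mulVec, ← Matrix.mul_assoc, ← Matrix.mul_assoc, hV,
        Matrix.one_mul]
    rw [hv, mulVec_zero] at this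
    simpa [mulVec_diagonal] using congrFun this x
  have hz : (Vᴴ * ρ * V) *ᵥ (Vᴴ *ᵥ v) = 0 := by
    ext y
    refine Finset.sum_eq_zero fun x _ => ?_
    change (Vᴴ * ρ * V) y x * (Vᴴ *ᵥ v) x = 0
    rcases mul_eq_zero.mp (hw x) with h0 | h0
    · rw [col_eq_zero_of_diag_eq_zero (hρ.conjTranspose_mul_mul_same V)
        (h x (by exact_mod_cast h0)), zero_mul]
    · rw [h0, mul_zero]
  calc ρ *ᵥ v = ((V * Vᴴ) * ρ * (V * Vᴴ)) *ᵥ v := by rw [hV', Matrix.one_mul, Matrix.mul_one]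
    _ = V *ᵥ ((Vᴴ * ρ * V) *ᵥ (Vᴴ *ᵥ v)) := by
        simp only [mulVec_mulVec, Matrix.mul_assoc]
    _ = 0 := by rw [hz, mulVec_zero]

end Spectral

section Overlap

variable {d : Type*} [Fintype d] [DecidableEq d]

lemma sum_normSq_row_of_unitary {M : Matrix d d ℂ} (hM : Mᴴ * M = 1) (x : d) :
    ∑ i, Complex.normSq (M x i) = 1 := by
  have hM' : M * Mᴴ = 1 := mul_eq_one_comm.mp hM
  have h := congrFun (congrFun hM' x) x
  rw [mul_apply, one_apply_eq] at h
  have h2 : ((∑ i, Complex.normSq (M x i) : ℝ) : ℂ) = 1 := by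
    rw [← h, Complex.ofReal_sum]
    exact Finset.sum_congr rfl fun i _ => by rw [Complex.normSq_eq_conj_mul_self]; exact mul_comm _ _
  exact_mod_cast h2

lemma sum_normSq_col_of_unitary {M : Matrix d d ℂ} (hM : Mᴴ * M = 1) (i : d) :
    ∑ x, Complex.normSq (M x i) = 1 := by
  have h := congrFun (congrFun hM i) i
  rw [mul_apply, one_apply_eq] at h
  have h2 : ((∑ x, Complex.normSq (M x i) : ℝ) : ℂ) = 1 := by
    rw [← h, Complex.ofReal_sum]
    exact Finset.sum_congr rfl fun x _ => by rw [Complex.normSq_eq_conj_mul_self]; rfl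
  exact_mod_cast h2

lemma conj_diagonal_diag (M : Matrix d d ℂ) (t : d → ℝ) (x : d) :
    (M * diagonal (fun i => (t i : ℂ)) * Mᴴ) x x =
      ((∑ i, Complex.normSq (M x i) * t i : ℝ) : ℂ) := by
  rw [mul_apply, Complex.ofReal_sum]
  refine Finset.sum_congr rfl fun i _ => ?_
  rw [mul_diagonal, conjTranspose_apply, Complex.ofReal_mul, Complex.normSq_eq_conj_mul_self,
    ← starRingEnd_apply]
  ring

lemma sum_normSq_conj_diagonal {M : Matrix d d ℂ} (hM : Mᴴ * M = 1) (t : d → ℝ) (x : d) :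
    ∑ y, Complex.normSq ((M * diagonal (fun i => (t i : ℂ)) * Mᴴ) x y) =
      ∑ i, Complex.normSq (M x i) * t i ^ 2 := by
  set N := M * diagonal (fun i => (t i : ℂ)) * Mᴴ with hN
  have h1 : N * Nᴴ = M * diagonal (fun i => ((t i ^ 2 : ℝ) : ℂ)) * Mᴴ := by
    rw [(isHermitian_conj_diagonal M t).eq, hN]
    calc M * diagonal (fun i => (t i : ℂ)) * Mᴴ * (M * diagonal (fun i => (t i : ℂ)) * Mᴴ)
        = M * (diagonal (fun i => (t i : ℂ)) * ((Mᴴ * M) * diagonal (fun i => (t i : ℂ)))) * Mᴴ := by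
          simp only [Matrix.mul_assoc]
      _ = _ := by
          rw [hM, Matrix.one_mul, diagonal_mul_diagonal]
          simp [sq]
  have h2 := conj_diagonal_diag M (fun i => t i ^ 2) x
  rw [← h1, mul_apply] at h2
  have h3 : ((∑ y, Complex.normSq (N x y) : ℝ) : ℂ) =
      ((∑ i, Complex.normSq (M x i) * t i ^ 2 : ℝ) : ℂ) := by
    rw [← h2, Complex.ofReal_sum]
    exact Finset.sum_congr rfl fun i _ => by rw [Complex.normSq_eq_conj_mul_self]; exact mul_comm _ _
  exact_mod_cast h3

end Overlap

section Classical

variable {ι κ : Type*} [Fintype ι] [Fintype κ]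

lemma logb_two_le_sub_one_div {x : ℝ} (hx : 0 < x) : Real.logb 2 x ≤ (x - 1) / Real.log 2 :=
  div_le_div_of_nonneg_right (Real.log_le_sub_one_of_pos hx) (Real.log_pos one_lt_two).le

/-- Transition-matrix form of a difference of entropies. -/
lemma sum_logb_sub_sum_logb (m : κ → ι → ℝ) (t : ι → ℝ) (e : κ → ℝ)
    (hcol : ∀ i, ∑ x, m x i = 1) :
    ∑ i, t i * Real.logb 2 (t i) - ∑ x, (∑ i, m x i * t i) * Real.logb 2 (e x) =
      ∑ x, ∑ i, m x i * t i * (Real.logb 2 (t i) - Real.logb 2 (e x)) := by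
  simp only [mul_sub, Finset.sum_sub_distrib, Finset.sum_mul]
  congr 1
  rw [Finset.sum_comm]
  refine Finset.sum_congr rfl fun i _ => ?_
  simp only [mul_assoc]
  rw [← Finset.sum_mul, hcol, one_mul]

lemma sum_logb_sub_le_logb (m : κ → ι → ℝ) (t : ι → ℝ) (e : κ → ℝ) (c : ℝ)
    (hm : ∀ x i, 0 ≤ m x i) (ht : ∀ i, 0 ≤ t i) (he : ∀ x, 0 ≤ e x)
    (hcol : ∀ i, ∑ x, m x i = 1) (ht1 : ∑ i, t i = 1)
    (hsupp : ∀ x, e x = 0 → ∑ i, m x i * t i = 0) (hc : 0 < c)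
    (hle : ∑ x, (e x)⁻¹ * ∑ i, m x i * t i ^ 2 ≤ c) :
    ∑ i, t i * Real.logb 2 (t i) - ∑ x, (∑ i, m x i * t i) * Real.logb 2 (e x) ≤
      Real.logb 2 c := by
  have hl2 : 0 < Real.log 2 := Real.log_pos one_lt_two
  have htot : ∑ x, ∑ i, m x i * t i = 1 := by
    rw [Finset.sum_comm]
    simp only [← Finset.sum_mul, hcol, one_mul, ht1]
  rw [sum_logb_sub_sum_logb m t e hcol]
  have hterm : ∀ x i, m x i * t i * (Real.logb 2 (t i) - Real.logb 2 (e x)) ≤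
      m x i * t i * Real.logb 2 c +
        ((e x)⁻¹ * (m x i * t i ^ 2) / c - m x i * t i) / Real.log 2 := by
    intro x i
    rcases (mul_nonneg (hm x i) (ht i)).eq_or_lt with h0 | h0
    · have := he x
      have := hm x i
      rw [← h0]
      simp only [zero_mul, zero_add, sub_zero]
      positivity
    · have hti : 0 < t i := (ht i).lt_of_ne fun h => by simp [← h] at h0
      have hex : 0 < e x := (he x).lt_of_ne fun h => by
        have := (Finset.sum_eq_zero_iff_of_nonneg
          (fun i _ => mul_nonneg (hm x i) (ht i))).mp (hsupp x h.symm) i (Finset.mem_univ i)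
        exact h0.ne' this
      have hlog := logb_two_le_sub_one_div (x := t i / (e x * c)) (by positivity)
      rw [Real.logb_div hti.ne' (by positivity), Real.logb_mul hex.ne' hc.ne'] at hlog
      have := mul_le_mul_of_nonneg_left hlog h0.le
      have e1 : m x i * t i * ((t i / (e x * c) - 1) / Real.log 2) =
          ((e x)⁻¹ * (m x i * t i ^ 2) / c - m x i * t i) / Real.log 2 := by
        field_simp
      linarith
  calc _ ≤ ∑ x, ∑ i, (m x i * t i * Real.logb 2 c +
        ((e x)⁻¹ * (m x i * t i ^ 2) / c - m x i * t i) / Real.log 2) :=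
        Finset.sum_le_sum fun x _ => Finset.sum_le_sum fun i _ => hterm x i
    _ = Real.logb 2 c +
        ((∑ x, (e x)⁻¹ * ∑ i, m x i * t i ^ 2) / c - 1) / Real.log 2 := by
        simp only [Finset.sum_add_distrib, ← Finset.sum_mul, ← Finset.sum_div,
          Finset.sum_sub_distrib, htot, one_mul, Finset.mul_sum]
    _ ≤ Real.logb 2 c := by
        have h1 : (∑ x, (e x)⁻¹ * ∑ i, m x i * t i ^ 2) / c ≤ 1 := (div_le_one hc).mpr hle
        have h2 := div_nonpos_of_nonpos_of_nonneg (sub_nonpos.mpr h1) hl2.le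
        linarith

lemma sum_logb_sub_nonneg (m : κ → ι → ℝ) (t : ι → ℝ) (e : κ → ℝ)
    (hm : ∀ x i, 0 ≤ m x i) (ht : ∀ i, 0 ≤ t i) (he : ∀ x, 0 ≤ e x)
    (hcol : ∀ i, ∑ x, m x i = 1) (hrow : ∀ x, ∑ i, m x i = 1)
    (ht1 : ∑ i, t i = 1) (he1 : ∑ x, e x = 1)
    (hsupp : ∀ x, e x = 0 → ∑ i, m x i * t i = 0) :
    0 ≤ ∑ i, t i * Real.logb 2 (t i) - ∑ x, (∑ i, m x i * t i) * Real.logb 2 (e x) := by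
  have hl2 : 0 < Real.log 2 := Real.log_pos one_lt_two
  have htot : ∑ x, ∑ i, m x i * t i = 1 := by
    rw [Finset.sum_comm]
    simp only [← Finset.sum_mul, hcol, one_mul, ht1]
  rw [sum_logb_sub_sum_logb m t e hcol]
  have hterm : ∀ x i, (m x i * t i - m x i * e x) / Real.log 2 ≤
      m x i * t i * (Real.logb 2 (t i) - Real.logb 2 (e x)) := by
    intro x i
    rcases (mul_nonneg (hm x i) (ht i)).eq_or_lt with h0 | h0
    · have := mul_nonneg (hm x i) (he x)
      rw [← h0]
      simp only [zero_mul, zero_sub]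
      exact div_nonpos_of_nonpos_of_nonneg (by linarith) hl2.le
    · have hti : 0 < t i := (ht i).lt_of_ne fun h => by simp [← h] at h0
      have hex : 0 < e x := (he x).lt_of_ne fun h => by
        have := (Finset.sum_eq_zero_iff_of_nonneg
          (fun i _ => mul_nonneg (hm x i) (ht i))).mp (hsupp x h.symm) i (Finset.mem_univ i)
        exact h0.ne' this
      have hlog := logb_two_le_sub_one_div (x := e x / t i) (by positivity)
      rw [Real.logb_div hex.ne' hti.ne'] at hlog
      have := mul_le_mul_of_nonneg_left hlog h0.le
      have e1 : m x i * t i * ((e x / t i - 1) / Real.log 2) =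
          -((m x i * t i - m x i * e x) / Real.log 2) := by
        field_simp
        ring
      linarith
  calc (0 : ℝ) = ∑ x, ∑ i, (m x i * t i - m x i * e x) / Real.log 2 := by
        simp only [← Finset.sum_div, Finset.sum_sub_distrib, htot, ← Finset.sum_mul, hrow,
          one_mul, he1, sub_self, zero_div]
    _ ≤ _ := Finset.sum_le_sum fun x _ => Finset.sum_le_sum fun i _ => hterm x i

end Classical

section SpectralEntropy

variable {d : Type*} [Fintype d] [DecidableEq d]

lemma exists_eq_conjTranspose_mul {A : Matrix d d ℂ} (hA : A.PosSemidef) :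
    ∃ B : Matrix d d ℂ, A = Bᴴ * B := by
  obtain ⟨V, e, -, he, rfl⟩ := exists_unitary_diagonal hA
  refine ⟨diagonal (fun i => (Real.sqrt (e i) : ℂ)) * Vᴴ, ?_⟩
  rw [conjTranspose_mul, conjTranspose_conjTranspose, diagonal_conjTranspose]
  have : diagonal (fun i => (e i : ℂ)) =
      diagonal (star fun i => (Real.sqrt (e i) : ℂ)) * diagonal (fun i => (Real.sqrt (e i) : ℂ)) := by
    rw [diagonal_mul_diagonal]
    congr 1
    ext i
    simp [← Complex.ofReal_mul, Real.mul_self_sqrt (he i)]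
  rw [this]
  simp only [Matrix.mul_assoc]

lemma unitary_conjTranspose_mul {U V : Matrix d d ℂ} (hU : Uᴴ * U = 1) (hV : Vᴴ * V = 1) :
    (Vᴴ * U)ᴴ * (Vᴴ * U) = 1 := by
  have hV' : V * Vᴴ = 1 := mul_eq_one_comm.mp hV
  rw [conjTranspose_mul, conjTranspose_conjTranspose]
  calc Uᴴ * V * (Vᴴ * U) = Uᴴ * (V * Vᴴ) * U := by simp only [Matrix.mul_assoc]
    _ = 1 := by rw [hV', Matrix.mul_one, hU]

lemma conjTranspose_mul_conj_mul (U V D : Matrix d d ℂ) :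
    Vᴴ * (U * D * Uᴴ) * V = (Vᴴ * U) * D * (Vᴴ * U)ᴴ := by
  rw [conjTranspose_mul, conjTranspose_conjTranspose]
  simp only [Matrix.mul_assoc]

lemma sum_eq_one_of_trace_eq_one {ρ U : Matrix d d ℂ} (hU : Uᴴ * U = 1) {t : d → ℝ}
    (hρ : ρ = U * diagonal (fun i => (t i : ℂ)) * Uᴴ) (hρ1 : ρ.trace = 1) :
    ∑ i, t i = 1 := by
  rw [hρ, Matrix.trace_mul_comm, ← Matrix.mul_assoc, hU, Matrix.one_mul, trace_diagonal] at hρ1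
  exact_mod_cast hρ1

/-- The relative entropy to `V diag(e) V†` is at most the logarithm of the collision
quantity `Tr(ρ² V diag(e)⁻¹ V†)`. -/
lemma entropy_sub_le_logb {ρ U V : Matrix d d ℂ} (hU : Uᴴ * U = 1) (hV : Vᴴ * V = 1)
    {t e : d → ℝ} (hρ : ρ = U * diagonal (fun i => (t i : ℂ)) * Uᴴ) (ht : ∀ i, 0 ≤ t i)
    (hρ1 : ρ.trace = 1) (he : ∀ x, 0 ≤ e x)
    (hsupp : ∀ x, e x = 0 → (Vᴴ * ρ * V) x x = 0) {c : ℝ} (hc : 0 < c)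
    (hle : ∑ x, (e x)⁻¹ * ∑ y, Complex.normSq ((Vᴴ * ρ * V) x y) ≤ c) :
    ∑ i, t i * Real.logb 2 (t i) - ∑ x, ((Vᴴ * ρ * V) x x).re * Real.logb 2 (e x) ≤
      Real.logb 2 c := by
  have hM := unitary_conjTranspose_mul hU hV
  have hN : Vᴴ * ρ * V =
      (Vᴴ * U) * diagonal (fun i => (t i : ℂ)) * (Vᴴ * U)ᴴ := by
    rw [hρ, conjTranspose_mul_conj_mul]
  simp only [hN, conj_diagonal_diag, sum_normSq_conj_diagonal hM, Complex.ofReal_re,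
    Complex.ofReal_eq_zero] at hsupp hle ⊢
  exact sum_logb_sub_le_logb _ t e c (fun _ _ => Complex.normSq_nonneg _) ht he
    (sum_normSq_col_of_unitary hM) (sum_eq_one_of_trace_eq_one hU hρ hρ1) hsupp hc hle

/-- Klein's inequality in spectral form. -/
lemma entropy_sub_nonneg {ρ U V : Matrix d d ℂ} (hU : Uᴴ * U = 1) (hV : Vᴴ * V = 1)
    {t e : d → ℝ} (hρ : ρ = U * diagonal (fun i => (t i : ℂ)) * Uᴴ) (ht : ∀ i, 0 ≤ t i)
    (hρ1 : ρ.trace = 1) (he : ∀ x, 0 ≤ e x) (he1 : ∑ x, e x = 1)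
    (hsupp : ∀ x, e x = 0 → (Vᴴ * ρ * V) x x = 0) :
    0 ≤ ∑ i, t i * Real.logb 2 (t i) -
      ∑ x, ((Vᴴ * ρ * V) x x).re * Real.logb 2 (e x) := by
  have hM := unitary_conjTranspose_mul hU hV
  have hN : Vᴴ * ρ * V =
      (Vᴴ * U) * diagonal (fun i => (t i : ℂ)) * (Vᴴ * U)ᴴ := by
    rw [hρ, conjTranspose_mul_conj_mul]
  simp only [hN, conj_diagonal_diag, Complex.ofReal_re, Complex.ofReal_eq_zero] at hsupp ⊢
  exact sum_logb_sub_nonneg _ t e (fun _ _ => Complex.normSq_nonneg _) ht he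
    (sum_normSq_col_of_unitary hM) (sum_normSq_row_of_unitary hM)
    (sum_eq_one_of_trace_eq_one hU hρ hρ1) he1 hsupp

/-- If `ρ ≤ K diag(e)`, then `Tr(ρ² diag(e)⁻¹) ≤ K Tr ρ`. -/
lemma collision_le_of_le_diagonal {ρ : Matrix d d ℂ} (hρ : ρ.PosSemidef) {e : d → ℝ}
    {K : ℝ} (hK : 0 < K)
    (hle : ∀ v : d → ℂ, (star v ⬝ᵥ (ρ *ᵥ v)).re ≤ K * ∑ x, e x * Complex.normSq (v x)) :
    ∑ x, (e x)⁻¹ * ∑ y, Complex.normSq (ρ x y) ≤ K * ρ.trace.re := by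
  have hcol : ∀ y, ∑ x, (e x)⁻¹ * Complex.normSq (ρ x y) ≤ K * (ρ y y).re := by
    intro y
    set X : ℝ := ∑ x, (e x)⁻¹ * Complex.normSq (ρ x y) with hX
    set v : d → ℂ := fun x => ((e x)⁻¹ : ℝ) * ρ x y with hv
    set w : d → ℂ := Pi.single y (K : ℂ) with hw
    have hρw : ρ *ᵥ w = fun x => ρ x y * K := by
      ext x
      simp [hw]
    have h1 : star w ⬝ᵥ (ρ *ᵥ w) = (K : ℂ) ^ 2 * ρ y y := by
      rw [hρw, hw, ← Pi.single_star, single_dotProduct]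
      simp only [Complex.star_def, Complex.conj_ofReal]
      ring
    have h2 : star v ⬝ᵥ (ρ *ᵥ w) = ((K * X : ℝ) : ℂ) := by
      rw [hρw, dotProduct, hX, Finset.mul_sum, Complex.ofReal_sum]
      refine Finset.sum_congr rfl fun x _ => ?_
      simp only [hv, Pi.star_apply, star_mul', Complex.star_def, Complex.conj_ofReal,
        Complex.ofReal_mul, Complex.normSq_eq_conj_mul_self]
      ring
    have h3 : star w ⬝ᵥ (ρ *ᵥ v) = ((K * X : ℝ) : ℂ) := by
      rw [hw, ← Pi.single_star, single_dotProduct, mulVec, dotProduct, hX, Complex.ofReal_mul,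
        Complex.ofReal_sum, Complex.star_def, Complex.conj_ofReal]
      congr 1
      refine Finset.sum_congr rfl fun x _ => ?_
      have : ρ y x = (starRingEnd ℂ) (ρ x y) := (hρ.1.apply y x).symm
      rw [this, hv, Complex.ofReal_mul, Complex.normSq_eq_conj_mul_self]
      ring
    have h4 : (star v ⬝ᵥ (ρ *ᵥ v)).re ≤ K * X := by
      refine (hle v).trans_eq ?_
      rw [hX]
      congr 1
      refine Finset.sum_congr rfl fun x _ => ?_
      rw [hv, Complex.normSq_mul, Complex.normSq_ofReal]
      by_cases h : e x = 0
      · simp [h]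
      · field_simp
    have h5 : 0 ≤ (star (w - v) ⬝ᵥ (ρ *ᵥ (w - v))).re :=
      (Complex.le_def.mp (hρ.dotProduct_mulVec_nonneg (w - v))).1
    have h6 : ((K : ℂ) ^ 2 * ρ y y).re = K ^ 2 * (ρ y y).re := by
      rw [← Complex.ofReal_pow, Complex.re_ofReal_mul]
    rw [star_sub, mulVec_sub, sub_dotProduct, dotProduct_sub, dotProduct_sub, h1, h2, h3,
      Complex.sub_re, Complex.sub_re, Complex.sub_re, h6, Complex.ofReal_re] at h5
    have h7 : K * X ≤ K * (K * (ρ y y).re) := by nlinarith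
    exact le_of_mul_le_mul_left h7 hK
  calc _ = ∑ y, ∑ x, (e x)⁻¹ * Complex.normSq (ρ x y) := by
        simp only [Finset.mul_sum]
        exact Finset.sum_comm
    _ ≤ ∑ y, K * (ρ y y).re := Finset.sum_le_sum fun y _ => hcol y
    _ = _ := by rw [← Finset.mul_sum, Matrix.trace, Complex.re_sum]; rfl

end SpectralEntropy

section BlockState

variable {P Q : Type*} [Fintype P] [Fintype Q] [DecidableEq P] [DecidableEq Q] {n : ℕ}

lemma sum_prod_pi {R ι κ : Type*} [CommSemiring R] [Fintype ι] [DecidableEq ι] [Fintype κ]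
    (f : ι → κ → R) : ∑ q : ι → κ, ∏ i, f i (q i) = ∏ i, ∑ a, f i a := by
  rw [Finset.prod_univ_sum, Fintype.piFinset_univ]

lemma blockState_eq_prod (ρ : Matrix (P × Q) (P × Q) ℂ) (σ : Matrix Q Q ℂ) (j : Fin n)
    (x y : P × (Fin n → Q)) :
    blockState ρ σ n j x y =
      ∏ i, if i = j then ρ (x.1, x.2 i) (y.1, y.2 i) else σ (x.2 i) (y.2 i) := by
  rw [← Finset.mul_prod_erase _ _ (Finset.mem_univ j), if_pos rfl, blockState]
  congr 1
  exact Finset.prod_congr rfl fun i hi => (if_neg (Finset.ne_of_mem_erase hi)).symm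

lemma blockState_mul (M M' : Matrix (P × Q) (P × Q) ℂ) (N N' : Matrix Q Q ℂ) (j : Fin n) :
    blockState M N n j * blockState M' N' n j = blockState (M * M') (N * N') n j := by
  ext ⟨p, q⟩ ⟨p', q'⟩
  rw [mul_apply, Fintype.sum_prod_type]
  simp only [blockState_eq_prod, ← Finset.prod_mul_distrib]
  have h : ∀ r : P, ∑ s : Fin n → Q,
      ∏ i, ((if i = j then M (p, q i) (r, s i) else N (q i) (s i)) *
        (if i = j then M' (r, s i) (p', q' i) else N' (s i) (q' i))) =
      (∑ a, M (p, q j) (r, a) * M' (r, a) (p', q' j)) *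
        ∏ i ∈ Finset.univ.erase j, (N * N') (q i) (q' i) := by
    intro r
    rw [sum_prod_pi (fun i a => (if i = j then M (p, q i) (r, a) else N (q i) a) *
        (if i = j then M' (r, a) (p', q' i) else N' a (q' i))),
      ← Finset.mul_prod_erase _ _ (Finset.mem_univ j)]
    simp only [if_true]
    congr 1
    refine Finset.prod_congr rfl fun i hi => ?_
    simp only [if_neg (Finset.ne_of_mem_erase hi), mul_apply]
  simp only [h, ← Finset.sum_mul]
  rw [← blockState_eq_prod (M * M') (N * N') j (p, q) (p', q'), blockState]
  simp only [mul_apply, Fintype.sum_prod_type]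

lemma blockState_conjTranspose (M : Matrix (P × Q) (P × Q) ℂ) (N : Matrix Q Q ℂ) (j : Fin n) :
    (blockState M N n j)ᴴ = blockState Mᴴ Nᴴ n j := by
  ext x y
  simp [blockState, conjTranspose_apply, star_prod]

lemma blockState_posSemidef {ρ : Matrix (P × Q) (P × Q) ℂ} {σ : Matrix Q Q ℂ}
    (hρ : ρ.PosSemidef) (hσ : σ.PosSemidef) (j : Fin n) :
    (blockState ρ σ n j).PosSemidef := by
  obtain ⟨A, rfl⟩ := exists_eq_conjTranspose_mul hρ
  obtain ⟨B, rfl⟩ := exists_eq_conjTranspose_mul hσ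
  rw [← blockState_mul, ← blockState_conjTranspose]
  exact posSemidef_conjTranspose_mul_self _

lemma ptrace2_blockState (ρ : Matrix (P × Q) (P × Q) ℂ) {σ : Matrix Q Q ℂ}
    (hσ : σ.trace = 1) (j : Fin n) : ptrace2 (blockState ρ σ n j) = ptrace2 ρ := by
  ext p p'
  simp only [ptrace2, blockState_eq_prod]
  rw [sum_prod_pi (fun i a => if i = j then ρ (p, a) (p', a) else σ a a),
    ← Finset.mul_prod_erase _ _ (Finset.mem_univ j)]
  simp only [if_true]
  rw [Finset.prod_eq_one, mul_one]
  intro i hi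
  simp only [if_neg (Finset.ne_of_mem_erase hi)]
  exact hσ

/-- The `n`-fold tensor power of a matrix. -/
def tensorPow (S : Matrix Q Q ℂ) (n : ℕ) : Matrix (Fin n → Q) (Fin n → Q) ℂ :=
  fun q q' => ∏ i, S (q i) (q' i)

lemma tensorPow_unitary {S : Matrix Q Q ℂ} (hS : Sᴴ * S = 1) :
    (tensorPow S n)ᴴ * tensorPow S n = 1 := by
  ext q q'
  simp only [mul_apply, conjTranspose_apply, tensorPow, star_prod, ← Finset.prod_mul_distrib]
  rw [sum_prod_pi fun i a => star (S a (q i)) * S a (q' i)]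
  have h : ∀ i, ∑ a, star (S a (q i)) * S a (q' i) = (1 : Matrix Q Q ℂ) (q i) (q' i) :=
    fun i => by rw [← hS, mul_apply]; rfl
  simp only [h]
  by_cases hq : q = q'
  · subst hq
    simp
  · obtain ⟨i, hi⟩ := Function.ne_iff.mp hq
    rw [one_apply_ne hq]
    exact Finset.prod_eq_zero (Finset.mem_univ i) (one_apply_ne hi)

lemma blockState_kronecker (V : Matrix P P ℂ) (S : Matrix Q Q ℂ) (j : Fin n) :
    blockState (V ⊗ₖ S) S n j = V ⊗ₖ tensorPow S n := by
  ext x y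
  change V x.1 y.1 * S (x.2 j) (y.2 j) * ∏ i ∈ Finset.univ.erase j, S (x.2 i) (y.2 i) =
    V x.1 y.1 * ∏ i, S (x.2 i) (y.2 i)
  rw [← Finset.mul_prod_erase _ _ (Finset.mem_univ j), mul_assoc]

lemma tensorPow_conj_convexSplit (ρ : Matrix (P × Q) (P × Q) ℂ) (σ : Matrix Q Q ℂ)
    (V : Matrix P P ℂ) (S : Matrix Q Q ℂ) :
    (V ⊗ₖ tensorPow S n)ᴴ * convexSplit ρ σ n * (V ⊗ₖ tensorPow S n) =
      convexSplit ((V ⊗ₖ S)ᴴ * ρ * (V ⊗ₖ S)) (Sᴴ * σ * S) n := by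
  simp only [convexSplit, Matrix.mul_smul, Matrix.smul_mul, Finset.mul_sum, Finset.sum_mul]
  congr 1
  refine Finset.sum_congr rfl fun j _ => ?_
  rw [← blockState_kronecker V S j, blockState_conjTranspose, blockState_mul, blockState_mul]

end BlockState

section ConvexSplitCollision

variable {P Q : Type*} [Fintype P] [Fintype Q] [DecidableEq P] [DecidableEq Q] {n : ℕ}

lemma sum_sum_prod_pi {R ι κ : Type*} [CommSemiring R] [Fintype ι] [DecidableEq ι] [Fintype κ]
    (f : ι → κ → κ → R) :
    ∑ q : ι → κ, ∑ q' : ι → κ, ∏ i, f i (q i) (q' i) = ∏ i, ∑ a, ∑ b, f i a b := by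
  rw [← sum_prod_pi fun i a => ∑ b, f i a b]
  exact Finset.sum_congr rfl fun q _ => sum_prod_pi fun i b => f i (q i) b

lemma sum_star_blockState_mul_blockState (ρ : Matrix (P × Q) (P × Q) ℂ) (σ : Matrix Q Q ℂ)
    (a : P → ℂ) (s : Q → ℂ) (j l : Fin n) :
    ∑ x : P × (Fin n → Q), ∑ y : P × (Fin n → Q), (a x.1 * ∏ i, s (x.2 i))⁻¹ *
        (star (blockState ρ σ n j x y) * blockState ρ σ n l x y) =
      ∑ p, ∑ p', (a p)⁻¹ * ∏ i, ∑ b, ∑ b', (s b)⁻¹ *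
        (star (if i = j then ρ (p, b) (p', b') else σ b b') *
          (if i = l then ρ (p, b) (p', b') else σ b b')) := by
  simp only [Fintype.sum_prod_type]
  refine Finset.sum_congr rfl fun p _ => ?_
  rw [Finset.sum_comm]
  refine Finset.sum_congr rfl fun p' _ => ?_
  rw [← sum_sum_prod_pi, Finset.mul_sum]
  refine Finset.sum_congr rfl fun q _ => ?_
  rw [Finset.mul_sum]
  refine Finset.sum_congr rfl fun q' _ => ?_
  rw [blockState_eq_prod, blockState_eq_prod, mul_inv, star_prod, mul_assoc, Finset.prod_mul_distrib,
    Finset.prod_mul_distrib, Finset.prod_inv_distrib]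

lemma sum_inv_mul_star_diagonal_mul {s : Q → ℝ} (f : Q → Q → ℂ) (hf : ∀ b, s b = 0 → f b b = 0) :
    ∑ b, ∑ b', ((s b : ℂ))⁻¹ * (f b b' * (diagonal (fun i => (s i : ℂ)) : Matrix Q Q ℂ) b b') =
      ∑ b, f b b := by
  refine Finset.sum_congr rfl fun b _ => ?_
  rw [Finset.sum_eq_single b]
  · rw [diagonal_apply_eq]
    by_cases h : s b = 0
    · simp [h, hf b h]
    · have : (s b : ℂ) ≠ 0 := by exact_mod_cast h
      field_simp
  · intro b' _ hb
    simp [diagonal_apply_ne _ hb.symm]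
  · simp

lemma star_ofReal_diagonal (s : Q → ℝ) (b b' : Q) :
    star ((diagonal (fun i => (s i : ℂ)) : Matrix Q Q ℂ) b b') =
      (diagonal (fun i => (s i : ℂ)) : Matrix Q Q ℂ) b b' := by
  by_cases h : b = b'
  · subst h; simp
  · simp [diagonal_apply_ne _ h]

variable {ρ : Matrix (P × Q) (P × Q) ℂ} {a : P → ℝ} {s : Q → ℝ}

lemma sum_star_blockState_mul_blockState_of_ne (hs1 : ∑ b, s b = 1)
    (hs0 : ∀ p p' b, s b = 0 → ρ (p, b) (p', b) = 0)
    (hA : ptrace2 ρ = diagonal (fun p => (a p : ℂ))) (ha1 : ∑ p, a p = 1)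
    {j l : Fin n} (hjl : j ≠ l) :
    ∑ x : P × (Fin n → Q), ∑ y : P × (Fin n → Q), ((a x.1 : ℂ) * ∏ i, (s (x.2 i) : ℂ))⁻¹ *
        (star (blockState ρ (diagonal fun b => (s b : ℂ)) n j x y) *
          blockState ρ (diagonal fun b => (s b : ℂ)) n l x y) = 1 := by
  rw [sum_star_blockState_mul_blockState ρ _ (fun p => (a p : ℂ)) (fun b => (s b : ℂ))]
  have hprod : ∀ p p', ∏ i, ∑ b, ∑ b', (s b : ℂ)⁻¹ *
        (star (if i = j then ρ (p, b) (p', b') else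
            (diagonal (fun b => (s b : ℂ)) : Matrix Q Q ℂ) b b') *
          (if i = l then ρ (p, b) (p', b') else
            (diagonal (fun b => (s b : ℂ)) : Matrix Q Q ℂ) b b')) =
      star (ptrace2 ρ p p') * ptrace2 ρ p p' := by
    intro p p'
    rw [Fintype.prod_eq_mul j l hjl]
    · simp only [if_true, if_neg hjl, if_neg hjl.symm]
      congr 1
      · rw [sum_inv_mul_star_diagonal_mul (fun b b' => star (ρ (p, b) (p', b')))
          (fun b hb => by simp [hs0 p p' b hb])]
        rw [ptrace2, star_sum]
      · simp only [star_ofReal_diagonal, mul_comm (diagonal (fun b => (s b : ℂ)) _ _)]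
        rw [sum_inv_mul_star_diagonal_mul (fun b b' => ρ (p, b) (p', b')) (hs0 p p')]
        rfl
    · rintro i ⟨hij, hil⟩
      simp only [if_neg hij, if_neg hil, star_ofReal_diagonal]
      rw [sum_inv_mul_star_diagonal_mul (fun b b' =>
        (diagonal (fun b => (s b : ℂ)) : Matrix Q Q ℂ) b b') (fun b hb => by simp [hb])]
      simp only [diagonal_apply_eq]
      exact_mod_cast hs1
  simp only [hprod, hA, star_ofReal_diagonal]
  have : ∀ p, ∑ p', (a p : ℂ)⁻¹ * ((diagonal (fun p => (a p : ℂ)) : Matrix P P ℂ) p p' *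
      (diagonal (fun p => (a p : ℂ)) : Matrix P P ℂ) p p') = a p := by
    intro p
    rw [Finset.sum_eq_single p]
    · rw [diagonal_apply_eq]
      by_cases h : (a p : ℂ) = 0
      · simp [h]
      · field_simp
    · intro p' _ hp
      simp [diagonal_apply_ne _ hp.symm]
    · simp
  simp only [this]
  exact_mod_cast ha1

lemma sum_star_blockState_mul_blockState_self (hs1 : ∑ b, s b = 1) (j : Fin n) :
    ∑ x : P × (Fin n → Q), ∑ y : P × (Fin n → Q), ((a x.1 : ℂ) * ∏ i, (s (x.2 i) : ℂ))⁻¹ *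
        (star (blockState ρ (diagonal fun b => (s b : ℂ)) n j x y) *
          blockState ρ (diagonal fun b => (s b : ℂ)) n j x y) =
      ((∑ x : P × Q, (a x.1 * s x.2)⁻¹ * ∑ y, Complex.normSq (ρ x y) : ℝ) : ℂ) := by
  rw [sum_star_blockState_mul_blockState ρ _ (fun p => (a p : ℂ)) (fun b => (s b : ℂ))]
  have hprod : ∀ p p', ∏ i, ∑ b, ∑ b', (s b : ℂ)⁻¹ *
        (star (if i = j then ρ (p, b) (p', b') else
            (diagonal (fun b => (s b : ℂ)) : Matrix Q Q ℂ) b b') *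
          (if i = j then ρ (p, b) (p', b') else
            (diagonal (fun b => (s b : ℂ)) : Matrix Q Q ℂ) b b')) =
      ∑ b, ∑ b', (s b : ℂ)⁻¹ * (star (ρ (p, b) (p', b')) * ρ (p, b) (p', b')) := by
    intro p p'
    rw [Fintype.prod_eq_single j]
    · simp only [if_true]
    · intro i hij
      simp only [if_neg hij, star_ofReal_diagonal]
      rw [sum_inv_mul_star_diagonal_mul (fun b b' =>
        (diagonal (fun b => (s b : ℂ)) : Matrix Q Q ℂ) b b') (fun b hb => by simp [hb])]
      simp only [diagonal_apply_eq]
      exact_mod_cast hs1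
  simp only [hprod]
  push_cast
  simp only [Fintype.sum_prod_type, Finset.mul_sum, Complex.normSq_eq_conj_mul_self]
  refine Finset.sum_congr rfl fun p _ => ?_
  rw [Finset.sum_comm]
  refine Finset.sum_congr rfl fun b _ => ?_
  refine Finset.sum_congr rfl fun p' _ => ?_
  refine Finset.sum_congr rfl fun b' _ => ?_
  rw [mul_inv, mul_assoc]
  rfl

lemma collision_convexSplit (hn : 0 < n) (hs1 : ∑ b, s b = 1)
    (hs0 : ∀ p p' b, s b = 0 → ρ (p, b) (p', b) = 0)
    (hA : ptrace2 ρ = diagonal (fun p => (a p : ℂ))) (ha1 : ∑ p, a p = 1) :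
    ∑ x : P × (Fin n → Q), (a x.1 * ∏ i, s (x.2 i))⁻¹ *
        ∑ y, Complex.normSq (convexSplit ρ (diagonal fun b => (s b : ℂ)) n x y) =
      ((∑ x : P × Q, (a x.1 * s x.2)⁻¹ * ∑ y, Complex.normSq (ρ x y)) + (n - 1)) / n := by
  set C : ℝ := ∑ x : P × Q, (a x.1 * s x.2)⁻¹ * ∑ y, Complex.normSq (ρ x y) with hC
  set σ : Matrix Q Q ℂ := diagonal fun b => (s b : ℂ) with hσ
  have hrow : ∀ j : Fin n, ∑ l : Fin n, ∑ x : P × (Fin n → Q), ∑ y : P × (Fin n → Q),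
      ((a x.1 : ℂ) * ∏ i, (s (x.2 i) : ℂ))⁻¹ *
        (star (blockState ρ σ n j x y) * blockState ρ σ n l x y) = C + (n - 1) := by
    intro j
    rw [← Finset.add_sum_erase _ _ (Finset.mem_univ j),
      sum_star_blockState_mul_blockState_self hs1 j, ← hC]
    congr 1
    rw [Finset.sum_congr rfl fun l hl => sum_star_blockState_mul_blockState_of_ne hs1 hs0 hA ha1
      (Finset.ne_of_mem_erase hl).symm]
    simp [Finset.card_erase_of_mem, Nat.cast_sub (Nat.one_le_iff_ne_zero.mpr hn.ne')]
  have hent : ∀ x y, ((Complex.normSq (convexSplit ρ σ n x y) : ℝ) : ℂ) =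
      ((n : ℂ)⁻¹) ^ 2 * ∑ j : Fin n, ∑ l : Fin n,
        star (blockState ρ σ n j x y) * blockState ρ σ n l x y := by
    intro x y
    rw [Complex.normSq_eq_conj_mul_self, convexSplit, Matrix.smul_apply, Matrix.sum_apply, smul_eq_mul, map_mul,
      map_inv₀, Complex.conj_natCast, map_sum, ← Finset.sum_mul_sum]
    simp only [starRingEnd_apply]
    ring
  have hmain : ((∑ x : P × (Fin n → Q), (a x.1 * ∏ i, s (x.2 i))⁻¹ *
        ∑ y, Complex.normSq (convexSplit ρ σ n x y) : ℝ) : ℂ) =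
      (((C + (n - 1)) / n : ℝ) : ℂ) := by
    push_cast
    simp only [hent]
    calc _ = ((n : ℂ)⁻¹) ^ 2 * ∑ j : Fin n, ∑ l : Fin n, ∑ x : P × (Fin n → Q),
          ∑ y : P × (Fin n → Q), ((a x.1 : ℂ) * ∏ i, (s (x.2 i) : ℂ))⁻¹ *
            (star (blockState ρ σ n j x y) * blockState ρ σ n l x y) := by
          simp only [Finset.mul_sum]
          rw [Finset.sum_congr rfl fun x _ => Finset.sum_comm, Finset.sum_comm]
          refine Finset.sum_congr rfl fun j _ => ?_
          rw [Finset.sum_congr rfl fun x _ => Finset.sum_comm, Finset.sum_comm]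
          refine Finset.sum_congr rfl fun l _ => Finset.sum_congr rfl fun x _ =>
            Finset.sum_congr rfl fun y _ => ?_
          ring
      _ = _ := by
          have hn' : (n : ℂ) ≠ 0 := by exact_mod_cast hn.ne'
          simp only [hrow, Finset.sum_const, Finset.card_univ, Fintype.card_fin, nsmul_eq_mul]
          field_simp
  exact_mod_cast hmain

end ConvexSplitCollision

section PartialTrace

variable {d₁ d₂ : Type*} [Fintype d₁] [Fintype d₂] [DecidableEq d₁] [DecidableEq d₂]

lemma kronecker_unitary {V : Matrix d₁ d₁ ℂ} {S : Matrix d₂ d₂ ℂ} (hV : Vᴴ * V = 1)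
    (hS : Sᴴ * S = 1) : (V ⊗ₖ S)ᴴ * (V ⊗ₖ S) = 1 := by
  rw [conjTranspose_kronecker, ← mul_kronecker_mul, hV, hS, one_kronecker_one]

lemma ptrace2_conj_kronecker (M : Matrix (d₁ × d₂) (d₁ × d₂) ℂ) (V : Matrix d₁ d₁ ℂ)
    {S : Matrix d₂ d₂ ℂ} (hS : Sᴴ * S = 1) :
    ptrace2 ((V ⊗ₖ S)ᴴ * M * (V ⊗ₖ S)) = Vᴴ * ptrace2 M * V := by
  have hS' : S * Sᴴ = 1 := mul_eq_one_comm.mp hS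
  ext i i'
  have hblk : ∀ k, ((V ⊗ₖ S)ᴴ * M * (V ⊗ₖ S)) (i, k) (i', k) =
      ∑ u', ∑ u, star (V u i) * V u' i' *
        (Sᴴ * (of fun w w' => M (u, w) (u', w')) * S) k k := by
    intro k
    simp only [mul_apply, Fintype.sum_prod_type, conjTranspose_apply, kroneckerMap_apply,
      star_mul', of_apply, Finset.sum_mul, Finset.mul_sum]
    refine Finset.sum_congr rfl fun u' _ => ?_
    rw [Finset.sum_comm]
    refine Finset.sum_congr rfl fun u _ => Finset.sum_congr rfl fun w' _ =>
      Finset.sum_congr rfl fun w _ => ?_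
    ring
  have htr : ∀ u u', ∑ k, (Sᴴ * (of fun w w' => M (u, w) (u', w')) * S) k k =
      ptrace2 M u u' := by
    intro u u'
    change (Sᴴ * (of fun w w' => M (u, w) (u', w')) * S).trace = _
    rw [Matrix.trace_mul_comm, ← Matrix.mul_assoc, hS', Matrix.one_mul]
    rfl
  rw [ptrace2]
  simp only [hblk]
  rw [Finset.sum_comm]
  rw [mul_apply]
  refine Finset.sum_congr rfl fun u' _ => ?_
  rw [Finset.sum_comm, mul_apply, Finset.sum_mul]
  refine Finset.sum_congr rfl fun u _ => ?_
  rw [← Finset.mul_sum, htr, conjTranspose_apply]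
  ring

lemma ptrace1_eq_ptrace2_swap (M : Matrix (d₁ × d₂) (d₁ × d₂) ℂ) :
    ptrace1 M = ptrace2 (M.submatrix Prod.swap Prod.swap) := rfl

lemma ptrace1_conj_kronecker (M : Matrix (d₁ × d₂) (d₁ × d₂) ℂ) {V : Matrix d₁ d₁ ℂ}
    (S : Matrix d₂ d₂ ℂ) (hV : Vᴴ * V = 1) :
    ptrace1 ((V ⊗ₖ S)ᴴ * M * (V ⊗ₖ S)) = Sᴴ * ptrace1 M * S := by
  have hswap : (V ⊗ₖ S).submatrix (Equiv.prodComm d₂ d₁) (Equiv.prodComm d₂ d₁) = S ⊗ₖ V := by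
    ext x y
    exact mul_comm _ _
  rw [ptrace1_eq_ptrace2_swap, ptrace1_eq_ptrace2_swap, ← ptrace2_conj_kronecker _ S hV, ← hswap,
    conjTranspose_submatrix, ← Equiv.coe_prodComm, submatrix_mul_equiv, submatrix_mul_equiv]

lemma trace_ptrace1 (M : Matrix (d₁ × d₂) (d₁ × d₂) ℂ) : (ptrace1 M).trace = M.trace := by
  rw [Matrix.trace, Matrix.trace, Fintype.sum_prod_type, Finset.sum_comm]
  rfl

lemma trace_ptrace2 (M : Matrix (d₁ × d₂) (d₁ × d₂) ℂ) : (ptrace2 M).trace = M.trace := by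
  rw [Matrix.trace, Matrix.trace, Fintype.sum_prod_type]
  rfl

lemma ptrace2_posSemidef {M : Matrix (d₁ × d₂) (d₁ × d₂) ℂ} (hM : M.PosSemidef) :
    (ptrace2 M).PosSemidef := by
  have : ptrace2 M = ∑ k, M.submatrix (fun i => (i, k)) (fun i => (i, k)) := by
    ext i i'
    simp [ptrace2, Matrix.sum_apply]
  rw [this]
  exact posSemidef_sum _ fun k _ => hM.submatrix _

lemma ptrace1_posSemidef {M : Matrix (d₁ × d₂) (d₁ × d₂) ℂ} (hM : M.PosSemidef) :
    (ptrace1 M).PosSemidef :=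
  ptrace2_posSemidef (hM.submatrix Prod.swap)

lemma diag_eq_zero_of_ptrace2_eq_zero {M : Matrix (d₁ × d₂) (d₁ × d₂) ℂ} (hM : M.PosSemidef)
    {i : d₁} (h : ptrace2 M i i = 0) (k : d₂) : M (i, k) (i, k) = 0 :=
  (Finset.sum_eq_zero_iff_of_nonneg fun _ _ => hM.diag_nonneg).mp h k (Finset.mem_univ k)

lemma diag_eq_zero_of_ptrace1_eq_zero {M : Matrix (d₁ × d₂) (d₁ × d₂) ℂ} (hM : M.PosSemidef)
    {k : d₂} (h : ptrace1 M k k = 0) (i : d₁) : M (i, k) (i, k) = 0 :=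
  (Finset.sum_eq_zero_iff_of_nonneg fun _ _ => hM.diag_nonneg).mp h i (Finset.mem_univ i)

lemma kronecker_conj_diagonal (V : Matrix d₁ d₁ ℂ) (S : Matrix d₂ d₂ ℂ) (a : d₁ → ℝ)
    (s : d₂ → ℝ) :
    (V * diagonal (fun i => (a i : ℂ)) * Vᴴ) ⊗ₖ (S * diagonal (fun i => (s i : ℂ)) * Sᴴ) =
      (V ⊗ₖ S) * diagonal (fun z => ((a z.1 * s z.2 : ℝ) : ℂ)) * (V ⊗ₖ S)ᴴ := by
  rw [mul_kronecker_mul, mul_kronecker_mul, diagonal_kronecker_diagonal, conjTranspose_kronecker]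
  simp

lemma sum_diag_mul_logb_mul {N : Matrix (d₁ × d₂) (d₁ × d₂) ℂ} (hN : N.PosSemidef)
    {a : d₁ → ℝ} {s : d₂ → ℝ} (hA : ptrace2 N = diagonal (fun i => (a i : ℂ)))
    (hs : ∀ x y, s y = 0 → N (x, y) (x, y) = 0) :
    ∑ z, (N z z).re * Real.logb 2 (a z.1 * s z.2) =
      ∑ x, a x * Real.logb 2 (a x) + ∑ y, (ptrace1 N y y).re * Real.logb 2 (s y) := by
  have hterm : ∀ x y, (N (x, y) (x, y)).re * Real.logb 2 (a x * s y) =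
      (N (x, y) (x, y)).re * Real.logb 2 (a x) + (N (x, y) (x, y)).re * Real.logb 2 (s y) := by
    intro x y
    by_cases hx : a x = 0
    · rw [diag_eq_zero_of_ptrace2_eq_zero hN (by simp [hA, hx])]
      simp
    by_cases hy : s y = 0
    · rw [hs x y hy]
      simp
    rw [Real.logb_mul hx hy, mul_add]
  rw [Fintype.sum_prod_type]
  simp only [hterm, Finset.sum_add_distrib]
  congr 1
  · refine Finset.sum_congr rfl fun x _ => ?_
    rw [← Finset.sum_mul, ← Complex.re_sum]
    congr 1
    have := congrFun (congrFun hA x) x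
    rw [diagonal_apply_eq] at this
    exact (congrArg Complex.re this).trans (Complex.ofReal_re _)
  · rw [Finset.sum_comm]
    refine Finset.sum_congr rfl fun y _ => ?_
    rw [← Finset.sum_mul, ← Complex.re_sum]
    rfl

/-- Mutual information is bounded by the logarithm of the collision quantity relative to the
product of the first marginal and an arbitrary second-factor state. -/
lemma mutInfo_le_logb {τ : Matrix (d₁ × d₂) (d₁ × d₂) ℂ} (hτ : IsDensityMatrix τ)
    {V : Matrix d₁ d₁ ℂ} {S : Matrix d₂ d₂ ℂ} (hV : Vᴴ * V = 1) (hS : Sᴴ * S = 1)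
    {a : d₁ → ℝ} {s : d₂ → ℝ} (hA : ptrace2 τ = V * diagonal (fun i => (a i : ℂ)) * Vᴴ)
    (ha : ∀ x, 0 ≤ a x) (hs : ∀ y, 0 ≤ s y) (hs1 : ∑ y, s y = 1)
    (hs0 : ∀ x y, s y = 0 → ((V ⊗ₖ S)ᴴ * τ * (V ⊗ₖ S)) (x, y) (x, y) = 0)
    {c : ℝ} (hc : 0 < c)
    (hle : ∑ z, (a z.1 * s z.2)⁻¹ *
      ∑ w, Complex.normSq (((V ⊗ₖ S)ᴴ * τ * (V ⊗ₖ S)) z w) ≤ c) :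
    mutInfo τ ≤ ((Real.logb 2 c : ℝ) : EReal) := by
  obtain ⟨U, t, hU, ht, hτU⟩ := exists_unitary_diagonal hτ.1
  obtain ⟨R, b, hR, hb, hB⟩ := exists_unitary_diagonal (ptrace1_posSemidef hτ.1)
  have hAB : ptrace2 τ ⊗ₖ ptrace1 τ = (V ⊗ₖ R) *
      diagonal (fun z => ((a z.1 * b z.2 : ℝ) : ℂ)) * (V ⊗ₖ R)ᴴ := by
    rw [hA, hB, kronecker_conj_diagonal]
  have hVR := kronecker_unitary hV hR
  have hVS := kronecker_unitary hV hS
  have hN := hτ.1.conjTranspose_mul_mul_same (V ⊗ₖ S)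
  have hN' := hτ.1.conjTranspose_mul_mul_same (V ⊗ₖ R)
  set N := (V ⊗ₖ S)ᴴ * τ * (V ⊗ₖ S) with hNdef
  set N' := (V ⊗ₖ R)ᴴ * τ * (V ⊗ₖ R) with hNdef'
  have hN2 : ptrace2 N = diagonal (fun i => (a i : ℂ)) := by
    rw [hNdef, ptrace2_conj_kronecker _ _ hS, hA, conjTranspose_mul_conj_diagonal_mul hV]
  have hN1 : ptrace1 N = Sᴴ * ptrace1 τ * S := ptrace1_conj_kronecker _ _ hV
  have hN2' : ptrace2 N' = diagonal (fun i => (a i : ℂ)) := by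
    rw [hNdef', ptrace2_conj_kronecker _ _ hR, hA, conjTranspose_mul_conj_diagonal_mul hV]
  have hN1' : ptrace1 N' = diagonal (fun i => (b i : ℂ)) := by
    rw [hNdef', ptrace1_conj_kronecker _ _ hV, hB, conjTranspose_mul_conj_diagonal_mul hR]
  have hb0' : ∀ x y, b y = 0 → N' (x, y) (x, y) = 0 := fun x y hy =>
    diag_eq_zero_of_ptrace1_eq_zero hN' (by simp [hN1', hy]) x
  have hsupp : SupportLE τ (ptrace2 τ ⊗ₖ ptrace1 τ) := by
    refine supportLE_of_diag hVR hτ.1 _ hAB fun z hz => ?_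
    rcases mul_eq_zero.mp hz with h | h
    · exact diag_eq_zero_of_ptrace2_eq_zero hN' (by simp [hN2', h]) z.2
    · exact hb0' z.1 z.2 h
  rw [mutInfo, relent, if_pos hsupp, EReal.coe_le_coe_iff,
    relentR_conj_diagonal hU hVR t _ hτU hAB, sum_diag_mul_logb_mul hN' hN2' hb0']
  have hbsum : ∑ y, (ptrace1 N' y y).re * Real.logb 2 (b y) = ∑ y, b y * Real.logb 2 (b y) := by
    simp [hN1']
  have hklein := entropy_sub_nonneg hR hS hB hb ((trace_ptrace1 τ).trans hτ.2) hs hs1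
    (fun y hy => by
      rw [← hN1]
      exact Finset.sum_eq_zero fun x _ => hs0 x y hy)
  rw [← hN1] at hklein
  have hmain := entropy_sub_le_logb hU hVS (e := fun z => a z.1 * s z.2) hτU ht hτ.2
    (fun z => mul_nonneg (ha z.1) (hs z.2))
    (fun z hz => by
      rcases mul_eq_zero.mp hz with h | h
      · exact diag_eq_zero_of_ptrace2_eq_zero hN (by simp [hN2, h]) z.2
      · exact hs0 z.1 z.2 h) hc hle
  rw [← hNdef, sum_diag_mul_logb_mul hN hN2 hs0] at hmain
  linarith

end PartialTrace

section ConvexSplit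

variable {P Q : Type*} [Fintype P] [Fintype Q] [DecidableEq P] [DecidableEq Q] {n : ℕ}

lemma ptrace2_convexSplit (hn : 0 < n) (ρ : Matrix (P × Q) (P × Q) ℂ) {σ : Matrix Q Q ℂ}
    (hσ : σ.trace = 1) : ptrace2 (convexSplit ρ σ n) = ptrace2 ρ := by
  have hlin : ptrace2 (convexSplit ρ σ n) =
      (n : ℂ)⁻¹ • ∑ j : Fin n, ptrace2 (blockState ρ σ n j) := by
    ext p p'
    simp only [ptrace2, convexSplit, Matrix.smul_apply, Matrix.sum_apply, smul_eq_mul, ← Finset.mul_sum]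
    rw [Finset.sum_comm]
  have hn' : (n : ℂ) ≠ 0 := by exact_mod_cast hn.ne'
  rw [hlin, Finset.sum_congr rfl fun j _ => ptrace2_blockState ρ hσ j, Finset.sum_const,
    Finset.card_univ, Fintype.card_fin, ← Nat.cast_smul_eq_nsmul ℂ, smul_smul,
    inv_mul_cancel₀ hn', one_smul]

lemma isDensityMatrix_convexSplit (hn : 0 < n) {ρ : Matrix (P × Q) (P × Q) ℂ}
    (hρ : IsDensityMatrix ρ) {σ : Matrix Q Q ℂ} (hσ : IsDensityMatrix σ) :
    IsDensityMatrix (convexSplit ρ σ n) := by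
  refine ⟨?_, ?_⟩
  · refine PosSemidef.smul (posSemidef_sum _ fun j _ => blockState_posSemidef hρ.1 hσ.1 j) ?_
    rw [← Complex.ofReal_natCast, ← Complex.ofReal_inv]
    exact_mod_cast inv_nonneg.mpr (Nat.cast_nonneg n)
  · rw [← trace_ptrace2, ptrace2_convexSplit hn ρ hσ.2, trace_ptrace2, hρ.2]

lemma le_two_rpow_of_dmax {d : Type*} [Fintype d] {ρ σ : Matrix d d ℂ} (hσ : σ.PosSemidef) {k : ℝ}
    (hk : dmax ρ σ = (k : EReal)) (v : d → ℂ) :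
    (star v ⬝ᵥ (ρ *ᵥ v)).re ≤ (2 : ℝ) ^ k * (star v ⬝ᵥ (σ *ᵥ v)).re := by
  have hσv : 0 ≤ (star v ⬝ᵥ (σ *ᵥ v)).re :=
    (Complex.le_def.mp (hσ.dotProduct_mulVec_nonneg v)).1
  have hgt : ∀ l : ℝ, k < l →
      (star v ⬝ᵥ (ρ *ᵥ v)).re ≤ (2 : ℝ) ^ l * (star v ⬝ᵥ (σ *ᵥ v)).re := by
    intro l hl
    have hlt : dmax ρ σ < (l : EReal) := by rw [hk]; exact_mod_cast hl
    obtain ⟨_, ⟨l', rfl, hl'⟩, hll⟩ := sInf_lt_iff.mp hlt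
    have h := (Complex.le_def.mp (hl'.dotProduct_mulVec_nonneg v)).1
    rw [sub_mulVec, dotProduct_sub, smul_mulVec, dotProduct_smul, Complex.sub_re,
      Complex.smul_re, Complex.zero_re, smul_eq_mul] at h
    have hpow : (2 : ℝ) ^ l' ≤ (2 : ℝ) ^ l :=
      Real.rpow_le_rpow_of_exponent_le one_le_two (by exact_mod_cast hll.le)
    have := mul_le_mul_of_nonneg_right hpow hσv
    linarith
  have hcont : Continuous fun l : ℝ => (2 : ℝ) ^ l * (star v ⬝ᵥ (σ *ᵥ v)).re :=
    (Real.continuous_const_rpow two_ne_zero).mul continuous_const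
  exact ge_of_tendsto (hcont.continuousWithinAt (s := Set.Ioi k) (x := k))
    (Filter.eventually_of_mem self_mem_nhdsWithin hgt)

/-- Convex-split bound in terms of the number of copies. -/
lemma mutInfo_convexSplit_le (hn : 0 < n) {ρ : Matrix (P × Q) (P × Q) ℂ}
    (hρ : IsDensityMatrix ρ) {σ : Matrix Q Q ℂ} (hσ : IsDensityMatrix σ) {k : ℝ}
    (hk : dmax ρ (ptrace2 ρ ⊗ₖ σ) = (k : EReal)) :
    mutInfo (convexSplit ρ σ n) ≤
      ((Real.logb 2 (((2 : ℝ) ^ k + (n - 1)) / n) : ℝ) : EReal) := by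
  have hρP := ptrace2_posSemidef hρ.1
  obtain ⟨V, a, hV, ha, hA⟩ := exists_unitary_diagonal hρP
  obtain ⟨S, s, hS, hs, hσS⟩ := exists_unitary_diagonal hσ.1
  have hs1 : ∑ b, s b = 1 := sum_eq_one_of_trace_eq_one hS hσS hσ.2
  have ha1 : ∑ p, a p = 1 := sum_eq_one_of_trace_eq_one hV hA ((trace_ptrace2 ρ).trans hρ.2)
  have hVS := kronecker_unitary hV hS
  have hVS' : (V ⊗ₖ S) * (V ⊗ₖ S)ᴴ = 1 := mul_eq_one_comm.mp hVS
  have hK : (0 : ℝ) < 2 ^ k := Real.rpow_pos_of_pos two_pos k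
  set ρ' := (V ⊗ₖ S)ᴴ * ρ * (V ⊗ₖ S) with hρ'
  have hρ'pos : ρ'.PosSemidef := hρ.1.conjTranspose_mul_mul_same _
  have hρ'tr : ρ'.trace = 1 := by
    rw [hρ', Matrix.trace_mul_comm, ← Matrix.mul_assoc, hVS', Matrix.one_mul, hρ.2]
  have hρ'A : ptrace2 ρ' = diagonal (fun p => (a p : ℂ)) := by
    rw [hρ', ptrace2_conj_kronecker _ _ hS, hA, conjTranspose_mul_conj_diagonal_mul hV]
  have hquad : ∀ (M : Matrix (P × Q) (P × Q) ℂ) (v : P × Q → ℂ),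
      star v ⬝ᵥ (((V ⊗ₖ S)ᴴ * M * (V ⊗ₖ S)) *ᵥ v) =
        star ((V ⊗ₖ S) *ᵥ v) ⬝ᵥ (M *ᵥ ((V ⊗ₖ S) *ᵥ v)) := by
    intro M v
    rw [star_mulVec, ← dotProduct_mulVec, mulVec_mulVec, mulVec_mulVec, Matrix.mul_assoc]
  have hle : ∀ v : P × Q → ℂ, (star v ⬝ᵥ (ρ' *ᵥ v)).re ≤
      (2 : ℝ) ^ k * ∑ x : P × Q, (a x.1 * s x.2) * Complex.normSq (v x) := by
    intro v
    rw [hρ', hquad]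
    refine (le_two_rpow_of_dmax (hρP.kronecker hσ.1) hk _).trans_eq ?_
    rw [← hquad]
    conv_lhs => rw [hA, hσS]
    rw [kronecker_conj_diagonal, conjTranspose_mul_conj_diagonal_mul hVS, dotProduct,
      Complex.re_sum]
    congr 1
    refine Finset.sum_congr rfl fun x _ => ?_
    rw [mulVec_diagonal, Pi.star_apply, Complex.star_def, mul_left_comm,
      ← Complex.normSq_eq_conj_mul_self, ← Complex.ofReal_mul, Complex.ofReal_re]
  have hcoll : ∑ x : P × Q, (a x.1 * s x.2)⁻¹ * ∑ y, Complex.normSq (ρ' x y) ≤ (2 : ℝ) ^ k := by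
    have := collision_le_of_le_diagonal hρ'pos hK hle
    rwa [hρ'tr, Complex.one_re, mul_one] at this
  have hdiag : ∀ p b, s b = 0 → ρ' (p, b) (p, b) = 0 := by
    intro p b hb
    have h1 := hle (Pi.single (p, b) 1)
    have h2 : ∑ x : P × Q, (a x.1 * s x.2) *
        Complex.normSq ((Pi.single (p, b) 1 : P × Q → ℂ) x) = 0 := by
      refine Finset.sum_eq_zero fun x _ => ?_
      by_cases hx : x = (p, b)
      · simp [hx, hb]
      · simp [Pi.single_eq_of_ne hx]
    rw [h2, mul_zero] at h1
    have h3 : (ρ' (p, b) (p, b)).re ≤ 0 := by simpa using h1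
    have h4 := Complex.le_def.mp (hρ'pos.diag_nonneg (i := (p, b)))
    exact Complex.ext (le_antisymm h3 h4.1) h4.2.symm
  have hs0 : ∀ p p' b, s b = 0 → ρ' (p, b) (p', b) = 0 := fun p p' b hb =>
    col_eq_zero_of_diag_eq_zero hρ'pos (hdiag p' b hb) (p, b)
  have hconj : (V ⊗ₖ tensorPow S n)ᴴ * convexSplit ρ σ n * (V ⊗ₖ tensorPow S n) =
      convexSplit ρ' (diagonal fun b => (s b : ℂ)) n := by
    rw [tensorPow_conj_convexSplit, ← hρ']
    conv_lhs => rw [hσS, conjTranspose_mul_conj_diagonal_mul hS]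
  refine mutInfo_le_logb (isDensityMatrix_convexSplit hn hρ hσ) hV (tensorPow_unitary hS)
    (a := a) (s := fun q => ∏ i, s (q i)) ((ptrace2_convexSplit hn ρ hσ.2).trans hA) ha
    (fun q => Finset.prod_nonneg fun i _ => hs _) ?_ ?_ ?_ ?_
  · rw [sum_prod_pi fun _ b => s b]
    simp [hs1]
  · intro p q hq
    obtain ⟨i, -, hi⟩ := Finset.prod_eq_zero_iff.mp hq
    rw [hconj, convexSplit, Matrix.smul_apply, Matrix.sum_apply, Finset.sum_eq_zero, smul_zero]
    intro j _
    rw [blockState_eq_prod]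
    refine Finset.prod_eq_zero (Finset.mem_univ i) ?_
    split_ifs
    · exact hs0 _ _ _ hi
    · simp [hi]
  · have : (1 : ℝ) ≤ n := by exact_mod_cast hn
    have : (0 : ℝ) ≤ n - 1 := by linarith
    positivity
  · rw [hconj, collision_convexSplit hn hs1 hs0 hρ'A ha1]
    gcongr

end ConvexSplit

lemma logb_copies_le {δ k : ℝ} (hδ0 : 0 < δ) (hδ1 : δ < 1 / 6) (hk : 3 * δ < k) {n : ℕ}
    (hn : n = ⌈8 * (2 : ℝ) ^ k * Real.logb 2 (k / δ) / δ ^ 3⌉₊) :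
    0 < n ∧ Real.logb 2 (((2 : ℝ) ^ k + (n - 1)) / n) ≤ 3 * δ := by
  have hK : (0 : ℝ) < 2 ^ k := Real.rpow_pos_of_pos two_pos k
  have hL : 1 ≤ Real.logb 2 (k / δ) := by
    rw [Real.le_logb_iff_rpow_le one_lt_two (div_pos (by linarith) hδ0), Real.rpow_one,
      le_div_iff₀ hδ0]
    linarith
  have hle : 8 * (2 : ℝ) ^ k * Real.logb 2 (k / δ) / δ ^ 3 ≤ n := hn ▸ Nat.le_ceil _
  have hle' : 8 * (2 : ℝ) ^ k / δ ^ 3 ≤ n := by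
    refine le_trans (div_le_div_of_nonneg_right ?_ (by positivity)) hle
    exact le_mul_of_one_le_right (by positivity) hL
  have hn0 : (0 : ℝ) < n := lt_of_lt_of_le (by positivity) hle'
  refine ⟨by exact_mod_cast hn0, ?_⟩
  have h1 : (2 : ℝ) ^ k / n ≤ δ ^ 3 / 8 := by
    rw [div_le_iff₀ (by positivity)] at hle'
    rw [div_le_div_iff₀ hn0 (by norm_num)]
    linarith
  have hpos : 0 < ((2 : ℝ) ^ k + (n - 1)) / n := by
    have : (1 : ℝ) ≤ n := by exact_mod_cast (by exact_mod_cast hn0 : 0 < n)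
    have : (0 : ℝ) ≤ n - 1 := by linarith
    positivity
  have h2 : ((2 : ℝ) ^ k + (n - 1)) / n - 1 ≤ δ ^ 3 / 8 := by
    have : ((2 : ℝ) ^ k + (n - 1)) / n - 1 = 2 ^ k / n - 1 / n := by
      field_simp
      ring
    have : (0 : ℝ) < 1 / n := by positivity
    linarith
  refine (logb_two_le_sub_one_div hpos).trans ?_
  have hl2 : 0.5 < Real.log 2 := by linarith [Real.log_two_gt_d9]
  rw [div_le_iff₀ (by linarith)]
  have h3 : δ ^ 3 ≤ δ := by nlinarith [sq_nonneg δ]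
  nlinarith

/-- **Convex-split lemma (mutual information bound).**
Let δ ∈ (0, 1/6), ρ_PQ a density matrix on P×Q, σ_Q a density matrix on Q with
k := Dmax(ρ_PQ ‖ ρ_P ⊗ σ_Q) finite.  With n := 1 if k ≤ 3δ and
n := ⌈8·2^k·log(k/δ)/δ³⌉ otherwise, the convex-split state τ satisfies
I(P : Q₁…Qₙ)_τ ≤ 3δ. -/
theorem convex_split_mutInfo {P Q : Type} [Fintype P] [Fintype Q]
    [DecidableEq P] [DecidableEq Q] [Nonempty P] [Nonempty Q]
    (δ : ℝ) (hδ0 : 0 < δ) (hδ1 : δ < 1 / 6)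
    (ρ : Matrix (P × Q) (P × Q) ℂ) (hρ : IsDensityMatrix ρ)
    (σ : Matrix Q Q ℂ) (hσ : IsDensityMatrix σ)
    (k : ℝ) (hk : dmax ρ (ptrace2 ρ ⊗ₖ σ) = (k : EReal))
    (n : ℕ)
    (hn : n = if k ≤ 3 * δ then 1 else ⌈8 * (2 : ℝ) ^ k * Real.logb 2 (k / δ) / δ ^ 3⌉₊) :
    mutInfo (convexSplit ρ σ n) ≤ ((3 * δ : ℝ) : EReal) := by
  by_cases h : k ≤ 3 * δ
  · rw [if_pos h] at hn
    subst hn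
    refine (mutInfo_convexSplit_le one_pos hρ hσ hk).trans ?_
    rw [Nat.cast_one, sub_self, add_zero, div_one, Real.logb_rpow two_pos (by norm_num)]
    exact_mod_cast h
  · rw [if_neg h] at hn
    obtain ⟨hn0, hle⟩ := logb_copies_le hδ0 hδ1 (not_le.mp h) hn
    exact (mutInfo_convexSplit_le hn0 hρ hσ hk).trans (by exact_mod_cast hle)

end
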